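/- arXiv:2605.16396 — 5 statements merged into one kernel-verified Lean document; each statement's English description precedes it below -/
import Mathlib

section
/- Let β ∈ (0,1), τ > 0, σ₀ > 0, and define the sequence (σ_k)_{k≥0} by σ_0 = σ₀ and σ_{k+1} = (1−β)·σ_k + β·σ₀/(1 + τ/σ_k²). Then σ_k → 0 as k → ∞ if and only if τ > σ₀²/4. -/
/-- The shrinkage term is at most linear, by the AM-GM inequality `2 √τ x ≤ x² + τ`. -/
lemma div_one_add_div_sq_le {τ a x : ℝ} (hτ : 0 < τ) (ha : 0 ≤ a) (hx : 0 < x) :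
    a / (1 + τ / x ^ 2) ≤ a / (2 * √τ) * x := by
  have hr : 0 < √τ := Real.sqrt_pos.2 hτ
  have hden : 2 * √τ / x ≤ 1 + τ / x ^ 2 := by
    have hsq : 0 ≤ (1 - √τ / x) ^ 2 := sq_nonneg _
    have hexp : (1 - √τ / x) ^ 2 = 1 + τ / x ^ 2 - 2 * √τ / x := by
      rw [sub_sq, div_pow, Real.sq_sqrt hτ.le]
      ring
    linarith
  calc a / (1 + τ / x ^ 2) ≤ a / (2 * √τ / x) :=
        div_le_div_of_nonneg_left ha (by positivity) hden
    _ = a / (2 * √τ) * x := by field_simp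

/-- The shrinkage term keeps at least half of `a` once `τ ≤ x²`. -/
lemma half_le_div_one_add_div_sq {τ a x : ℝ} (hτ : 0 < τ) (ha : 0 ≤ a) (hx : τ ≤ x ^ 2) :
    a / 2 ≤ a / (1 + τ / x ^ 2) := by
  have hle : τ / x ^ 2 ≤ 1 := div_le_one_of_le₀ hx (sq_nonneg x)
  exact div_le_div_of_nonneg_left ha (by positivity) (by linarith)

/-- The recursive noise sequence `σ_{k+1} = (1-β)σ_k + βσ₀/(1+τ/σ_k²)` with `σ_0 = σ₀`
tends to 0 if and only if `τ > σ₀²/4`. -/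
theorem noise_seq_tendsto_zero_iff
    (β τ σ₀ : ℝ) (hβ0 : 0 < β) (hβ1 : β < 1) (hτ : 0 < τ) (hσ₀ : 0 < σ₀)
    (s : ℕ → ℝ) (h0 : s 0 = σ₀)
    (hrec : ∀ k, s (k + 1) = (1 - β) * s k + β * σ₀ / (1 + τ / (s k) ^ 2)) :
    Filter.Tendsto s Filter.atTop (nhds 0) ↔ τ > σ₀ ^ 2 / 4 := by
  have hβ : 0 < 1 - β := sub_pos.2 hβ1
  have ha : 0 ≤ β * σ₀ := by positivity
  constructor
  · intro hlim
    by_contra! hle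
    have hlow : ∀ k, σ₀ / 2 ≤ s k := by
      intro k
      induction k with
      | zero => linarith
      | succ k ih =>
        have hsq : τ ≤ s k ^ 2 := by nlinarith
        have hterm := half_le_div_one_add_div_sq hτ ha hsq
        have hmul := mul_le_mul_of_nonneg_left ih hβ.le
        rw [hrec]
        linarith
    have := ge_of_tendsto' hlim hlow
    linarith
  · intro hgt
    have hpos : ∀ k, 0 < s k := by
      intro k
      induction k with
      | zero => rwa [h0]
      | succ k ih =>
        rw [hrec]
        positivity
    have hr : 0 < √τ := Real.sqrt_pos.2 hτ
    have hroot : σ₀ / 2 < √τ := Real.lt_sqrt_of_sq_lt (by linarith [div_pow σ₀ 2 2])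
    set q := 1 - β + β * σ₀ / (2 * √τ) with hq
    have hq0 : 0 ≤ q := by positivity
    have hq1 : q < 1 := by
      have : β * σ₀ / (2 * √τ) < β := by
        rw [div_lt_iff₀ (by positivity)]
        exact mul_lt_mul_of_pos_left (by linarith) hβ0
      linarith
    have hgeom : ∀ k, s k ≤ q ^ k * σ₀ := by
      intro k
      induction k with
      | zero => simp [h0]
      | succ k ih =>
        calc s (k + 1) ≤ q * s k := by
              rw [hrec, hq, add_mul]
              linarith [div_one_add_div_sq_le hτ ha (hpos k)]
          _ ≤ q * (q ^ k * σ₀) := mul_le_mul_of_nonneg_left ih hq0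
          _ = q ^ (k + 1) * σ₀ := by ring
    refine squeeze_zero (fun k => (hpos k).le) hgeom ?_
    simpa using (tendsto_pow_atTop_nhds_zero_of_lt_one hq0 hq1).mul_const σ₀
end

section
/- Let β ∈ (0,1), τ > 0, σ₀ > 0, and define the sequence (σ_k)_{k≥0} by σ_0 = σ₀ and σ_{k+1} = (1−β)·σ_k + β·σ₀/(1 + τ/σ_k²). If τ > σ₀²/4, then σ_k → 0 as k → ∞. -/
/-- By AM-GM, `σ₀ / (1 + r² / x²) ≤ (σ₀ / (2r)) x` for positive `x` and `r`. -/
lemma div_one_add_sq_div_sq_le {σ₀ r x : ℝ} (hσ₀ : 0 ≤ σ₀) (hr : 0 < r) (hx : 0 < x) :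
    σ₀ / (1 + r ^ 2 / x ^ 2) ≤ σ₀ / (2 * r) * x := by
  have key : 1 / (1 + r ^ 2 / x ^ 2) ≤ x / (2 * r) := by
    have h : 1 + r ^ 2 / x ^ 2 = (x ^ 2 + r ^ 2) / x ^ 2 := by field_simp
    rw [h, one_div_div, div_le_div_iff₀ (by positivity) (by positivity)]
    nlinarith [mul_nonneg hx.le (sq_nonneg (x - r))]
  calc σ₀ / (1 + r ^ 2 / x ^ 2) = σ₀ * (1 / (1 + r ^ 2 / x ^ 2)) := by ring
    _ ≤ σ₀ * (x / (2 * r)) := mul_le_mul_of_nonneg_left key hσ₀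
    _ = σ₀ / (2 * r) * x := by ring

/-- If `τ > σ₀²/4`, the recursive noise sequence
`σ_{k+1} = (1-β)σ_k + βσ₀/(1+τ/σ_k²)` with `σ_0 = σ₀` tends to 0. -/
theorem noise_seq_tendsto_zero_of_tau_gt
    (β τ σ₀ : ℝ) (hβ0 : 0 < β) (hβ1 : β < 1) (hτ : 0 < τ) (hσ₀ : 0 < σ₀)
    (s : ℕ → ℝ) (h0 : s 0 = σ₀)
    (hrec : ∀ k, s (k + 1) = (1 - β) * s k + β * σ₀ / (1 + τ / (s k) ^ 2))
    (hτ4 : τ > σ₀ ^ 2 / 4) :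
    Filter.Tendsto s Filter.atTop (nhds 0) := by
  obtain ⟨r, hr, rfl⟩ : ∃ r : ℝ, 0 < r ∧ r ^ 2 = τ :=
    ⟨√τ, Real.sqrt_pos.2 hτ, Real.sq_sqrt hτ.le⟩
  have h1β : 0 < 1 - β := sub_pos.2 hβ1
  have hpos : ∀ k, 0 < s k := by
    intro k
    induction k with
    | zero => rwa [h0]
    | succ k ih => rw [hrec]; positivity
  set c := σ₀ / (2 * r) with hc
  have hc0 : 0 < c := by positivity
  have hc1 : c < 1 := by
    rw [hc, div_lt_one (by positivity)]
    nlinarith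
  have hq0 : 0 ≤ 1 - β + β * c := by positivity
  have hq1 : 1 - β + β * c < 1 := by nlinarith
  have hstep : ∀ k, s (k + 1) ≤ (1 - β + β * c) * s k := by
    intro k
    have h := mul_le_mul_of_nonneg_left
      (div_one_add_sq_div_sq_le hσ₀.le hr (hpos k)) hβ0.le
    rw [hrec, mul_div_assoc]
    linarith
  have hbound : ∀ k, s k ≤ (1 - β + β * c) ^ k * σ₀ := by
    intro k
    induction k with
    | zero => simp [h0]
    | succ k ih =>
      calc s (k + 1) ≤ (1 - β + β * c) * s k := hstep k
        _ ≤ (1 - β + β * c) * ((1 - β + β * c) ^ k * σ₀) :=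
          mul_le_mul_of_nonneg_left ih hq0
        _ = (1 - β + β * c) ^ (k + 1) * σ₀ := by ring
  refine squeeze_zero (fun k => (hpos k).le) hbound ?_
  simpa using (tendsto_pow_atTop_nhds_zero_of_lt_one hq0 hq1).mul_const σ₀
end

section
/- Let β ∈ (0,1), τ > 0, σ₀ > 0, and define the sequence (σ_k)_{k≥0} by σ_0 = σ₀ and σ_{k+1} = (1−β)·σ_k + β·σ₀/(1 + τ/σ_k²). If τ ≤ σ₀²/4, then (σ_k) does not converge to 0; in fact every term satisfies σ_k ≥ σ₊ := (σ₀ + √(σ₀² − 4τ))/2 > 0. -/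
/-- A positive root `p` of `p ^ 2 + τ = c * p` is a lower barrier for the map
`x ↦ (1 - β) * x + β * c / (1 + τ / x ^ 2)`. -/
theorem le_noise_step_of_le {β τ c p x : ℝ} (hβ0 : 0 ≤ β) (hβ1 : β ≤ 1) (hτ : 0 ≤ τ)
    (hp : 0 < p) (hroot : p ^ 2 + τ = c * p) (hx : p ≤ x) :
    p ≤ (1 - β) * x + β * c / (1 + τ / x ^ 2) := by
  have hfix : p * (1 + τ / p ^ 2) = c := by
    field_simp
    linarith
  have hbound : p ≤ c / (1 + τ / x ^ 2) := by
    rw [le_div_iff₀ (by positivity)]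
    calc p * (1 + τ / x ^ 2) ≤ p * (1 + τ / p ^ 2) := by gcongr
      _ = c := hfix
  calc p = (1 - β) * p + β * p := by ring
    _ ≤ (1 - β) * x + β * (c / (1 + τ / x ^ 2)) :=
      add_le_add (mul_le_mul_of_nonneg_left hx (sub_nonneg.2 hβ1))
        (mul_le_mul_of_nonneg_left hbound hβ0)
    _ = (1 - β) * x + β * c / (1 + τ / x ^ 2) := by rw [mul_div_assoc]

/-- If `τ ≤ σ₀²/4`, the recursive noise sequence does not converge to 0; in fact every
term is bounded below by the positive fixed point `σ₊ = (σ₀ + √(σ₀² - 4τ))/2 > 0`. -/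
theorem noise_seq_not_tendsto_zero_of_tau_le
    (β τ σ₀ : ℝ) (hβ0 : 0 < β) (hβ1 : β < 1) (hτ : 0 < τ) (hσ₀ : 0 < σ₀)
    (s : ℕ → ℝ) (h0 : s 0 = σ₀)
    (hrec : ∀ k, s (k + 1) = (1 - β) * s k + β * σ₀ / (1 + τ / (s k) ^ 2))
    (hτ4 : τ ≤ σ₀ ^ 2 / 4) :
    0 < (σ₀ + Real.sqrt (σ₀ ^ 2 - 4 * τ)) / 2 ∧
    (∀ k, (σ₀ + Real.sqrt (σ₀ ^ 2 - 4 * τ)) / 2 ≤ s k) ∧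
    ¬ Filter.Tendsto s Filter.atTop (nhds 0) := by
  have hsq : Real.sqrt (σ₀ ^ 2 - 4 * τ) ^ 2 = σ₀ ^ 2 - 4 * τ := Real.sq_sqrt (by linarith)
  have hsqrt_le : Real.sqrt (σ₀ ^ 2 - 4 * τ) ≤ σ₀ :=
    Real.sqrt_le_iff.2 ⟨hσ₀.le, by linarith⟩
  have hpos : 0 < (σ₀ + Real.sqrt (σ₀ ^ 2 - 4 * τ)) / 2 := by positivity
  have hle : ∀ k, (σ₀ + Real.sqrt (σ₀ ^ 2 - 4 * τ)) / 2 ≤ s k := by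
    intro k
    induction k with
    | zero => linarith
    | succ k ih =>
      rw [hrec]
      exact le_noise_step_of_le hβ0.le hβ1.le hτ.le hpos (by linarith) ih
  exact ⟨hpos, hle, fun h => hpos.not_ge (ge_of_tendsto' h hle)⟩
end

section
/- Let β ∈ (0,1), σ₀ > 0, and 0 < τ ≤ σ₀²/4, and define the sequence (σ_k)_{k≥0} by σ_0 = σ₀ and σ_{k+1} = (1−β)·σ_k + β·σ₀/(1 + τ/σ_k²). Then (σ_k) is nonincreasing, bounded below by σ₊ := (σ₀ + √(σ₀² − 4τ))/2, and converges to σ₊ as k → ∞. -/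
open Filter Topology in
/-- A sequence obtained by averaging with the map `x ↦ σ₀ / (1 + τ / x ^ 2)`, started above the
larger fixed point `p` of that map, decreases to `p`. -/
theorem antitone_and_tendsto_of_averaged_recursion
    {β τ σ₀ p : ℝ} (hβ0 : 0 < β) (hβ1 : β < 1) (hτ : 0 < τ)
    (hp : 0 < p) (hfix : p ^ 2 + τ = σ₀ * p) (hhalf : σ₀ ≤ 2 * p)
    {s : ℕ → ℝ} (h0 : p ≤ s 0)
    (hrec : ∀ k, s (k + 1) = (1 - β) * s k + β * σ₀ / (1 + τ / (s k) ^ 2)) :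
    Antitone s ∧ (∀ k, p ≤ s k) ∧ Tendsto s atTop (𝓝 p) := by
  have hlow : ∀ k, p ≤ s k := by
    intro k
    induction k with
    | zero => exact h0
    | succ k ih =>
      have hx : 0 < s k := hp.trans_le ih
      have hmap : β * p ≤ β * σ₀ / (1 + τ / (s k) ^ 2) := by
        rw [le_div_iff₀ (by positivity), mul_assoc]
        refine mul_le_mul_of_nonneg_left ?_ hβ0.le
        calc p * (1 + τ / (s k) ^ 2) ≤ p * (1 + τ / p ^ 2) := by gcongr
          _ = (p ^ 2 + τ) / p := by field_simp
          _ = σ₀ := by rw [hfix]; field_simp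
      rw [hrec]
      nlinarith [mul_le_mul_of_nonneg_left ih (sub_nonneg.2 hβ1.le)]
  have hanti : Antitone s := by
    refine antitone_nat_of_succ_le fun k => ?_
    have hx : 0 < s k := hp.trans_le (hlow k)
    have hmap : β * σ₀ / (1 + τ / (s k) ^ 2) ≤ β * s k := by
      rw [div_le_iff₀ (by positivity), mul_assoc]
      refine mul_le_mul_of_nonneg_left ?_ hβ0.le
      have heq : s k * (1 + τ / (s k) ^ 2) = ((s k) ^ 2 + τ) / s k := by field_simp
      rw [heq, le_div_iff₀ hx]
      nlinarith [mul_nonneg (sub_nonneg.2 (hlow k))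
        (by linarith [hlow k] : 0 ≤ s k + p - σ₀)]
    rw [hrec]
    linarith
  refine ⟨hanti, hlow, ?_⟩
  obtain ⟨L, hL⟩ : ∃ L, Tendsto s atTop (𝓝 L) :=
    ⟨_, tendsto_atTop_ciInf hanti ⟨p, by rintro _ ⟨k, rfl⟩; exact hlow k⟩⟩
  have hpL : p ≤ L := ge_of_tendsto' hL hlow
  have hL0 : 0 < L := hp.trans_le hpL
  have hden : 1 + τ / L ^ 2 ≠ 0 := by positivity
  have hlim : Tendsto (fun k => s (k + 1)) atTop
      (𝓝 ((1 - β) * L + β * σ₀ / (1 + τ / L ^ 2))) := by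
    simp only [hrec]
    exact (hL.const_mul _).add (tendsto_const_nhds.div
      (tendsto_const_nhds.add (tendsto_const_nhds.div (hL.pow 2) (by positivity))) hden)
  have hLfix := tendsto_nhds_unique ((tendsto_add_atTop_iff_nat 1).2 hL) hlim
  have hmul : β * L * (1 + τ / L ^ 2) = β * σ₀ := by
    rw [← eq_div_iff hden]
    linarith
  have hquad : L ^ 2 + τ = σ₀ * L := by
    field_simp at hmul
    linarith
  have hprod : (L - p) * (L + p - σ₀) = 0 := by linear_combination hquad - hfix
  have hLp : L = p := by
    rcases mul_eq_zero.1 hprod with h | h <;> linarith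
  rwa [hLp] at hL

/-- If `0 < τ ≤ σ₀²/4`, the recursive noise sequence is nonincreasing, bounded below by
`σ₊ = (σ₀ + √(σ₀² - 4τ))/2`, and converges to `σ₊`. -/
theorem noise_seq_tendsto_sigmaPlus_of_tau_le
    (β τ σ₀ : ℝ) (hβ0 : 0 < β) (hβ1 : β < 1) (hτ : 0 < τ) (hσ₀ : 0 < σ₀)
    (s : ℕ → ℝ) (h0 : s 0 = σ₀)
    (hrec : ∀ k, s (k + 1) = (1 - β) * s k + β * σ₀ / (1 + τ / (s k) ^ 2))
    (hτ4 : τ ≤ σ₀ ^ 2 / 4) :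
    Antitone s ∧
    (∀ k, (σ₀ + Real.sqrt (σ₀ ^ 2 - 4 * τ)) / 2 ≤ s k) ∧
    Filter.Tendsto s Filter.atTop (nhds ((σ₀ + Real.sqrt (σ₀ ^ 2 - 4 * τ)) / 2)) := by
  have hdisc : 0 ≤ σ₀ ^ 2 - 4 * τ := by linarith
  have hsq := Real.sq_sqrt hdisc
  have hnonneg := Real.sqrt_nonneg (σ₀ ^ 2 - 4 * τ)
  have hle : Real.sqrt (σ₀ ^ 2 - 4 * τ) ≤ σ₀ :=
    Real.sqrt_le_iff.2 ⟨hσ₀.le, by linarith⟩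
  refine antitone_and_tendsto_of_averaged_recursion hβ0 hβ1 hτ ?_ ?_ ?_ ?_ hrec
  · linarith
  · linear_combination hsq / 4
  · linarith
  · linarith
end

section
/- Let β ∈ (0,1), σ₀ > 0, and 0 < τ ≤ σ₀²/4, let f(σ) = (1−β)σ + βσ₀σ²/(σ² + τ), and set σ₊ = (σ₀ + √(σ₀² − 4τ))/2. Then for every σ with σ ≥ σ₊, one has σ₊ ≤ f(σ) ≤ σ; that is, the interval [σ₊, ∞) is invariant under f and f is non-expansive upward on it. -/
/-- If `0 < τ ≤ σ₀²/4` and `σ₊ = (σ₀ + √(σ₀² - 4τ))/2`, then for every `σ ≥ σ₊` one has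
`σ₊ ≤ f(σ) ≤ σ`, where `f(σ) = (1-β)σ + βσ₀σ²/(σ²+τ)`. -/
theorem f_invariant_above_sigmaPlus
    (β τ σ₀ : ℝ) (hβ0 : 0 < β) (hβ1 : β < 1) (hτ : 0 < τ) (hσ₀ : 0 < σ₀)
    (hτ4 : τ ≤ σ₀ ^ 2 / 4)
    (σ : ℝ) (hσ : (σ₀ + Real.sqrt (σ₀ ^ 2 - 4 * τ)) / 2 ≤ σ) :
    (σ₀ + Real.sqrt (σ₀ ^ 2 - 4 * τ)) / 2 ≤ (1 - β) * σ + β * σ₀ * σ ^ 2 / (σ ^ 2 + τ) ∧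
    (1 - β) * σ + β * σ₀ * σ ^ 2 / (σ ^ 2 + τ) ≤ σ := by
  have hs : Real.sqrt (σ₀ ^ 2 - 4 * τ) ^ 2 = σ₀ ^ 2 - 4 * τ := Real.sq_sqrt (by linarith)
  have hs0 := Real.sqrt_nonneg (σ₀ ^ 2 - 4 * τ)
  set p := (σ₀ + Real.sqrt (σ₀ ^ 2 - 4 * τ)) / 2 with hp
  have hp_pos : 0 < p := by linarith
  have hp_half : σ₀ ≤ 2 * p := by linarith
  have hroot : (σ₀ - p) * p = τ := by
    rw [hp]
    linear_combination -hs / 4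
  have hq_pos : 0 < σ₀ - p := pos_of_mul_pos_left (hroot ▸ hτ) hp_pos.le
  have hden : 0 < σ ^ 2 + τ := by positivity
  have hlower : p ≤ σ₀ * σ ^ 2 / (σ ^ 2 + τ) := by
    rw [le_div_iff₀ hden]
    have hsq : p ^ 2 ≤ σ ^ 2 := pow_le_pow_left₀ hp_pos.le hσ 2
    have hmul := mul_le_mul_of_nonneg_left hsq hq_pos.le
    linear_combination hmul - p * hroot
  have hupper : σ₀ * σ ^ 2 / (σ ^ 2 + τ) ≤ σ := by
    rw [div_le_iff₀ hden]
    have hfactor : 0 ≤ σ * ((σ - p) * (σ - (σ₀ - p))) :=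
      mul_nonneg (by linarith) (mul_nonneg (by linarith) (by linarith))
    linear_combination hfactor + σ * hroot
  rw [mul_assoc β, mul_div_assoc β]
  constructor
  · linear_combination (1 - β) * hσ + β * hlower
  · linear_combination β * hupper
end
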